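/- arXiv:1409.7938 — 6 statements merged into one kernel-verified Lean document; each statement's English description precedes it below -/
import Mathlib

section
/- Let V be a finite ground set of size n, let f : Finset V → ℝ be a non-negative monotone submodular set function, let k ≥ 1 be a cardinality constraint with k ≤ n, let ε ∈ (0,1), and let s = ⌈(n/k)·log(1/ε)⌉. Consider the Stochastic-Greedy random process, modeled as a probability mass function over sequences of sets: A₀ = ∅, and for i = 1,…,k, a multiset R_i of s elements is drawn by sampling s elements independently and uniformly at random (with repetition) from V \ A_{i−1}, and A_i = A_{i−1} ∪ {a_i} where a_i maximizes the marginal gain Δ(a|A_{i−1}) = f(A_{i−1} ∪ {a}) − f(A_{i−1}) over a ∈ R_i. Then the expected value of f(A_k) satisfies E[f(A_k)] ≥ (1 − 1/e − ε) · f(A*), where A* is any set of size at most k maximizing f among sets of size at most k. -/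
open Finset

/-- One step of the Stochastic-Greedy process: from the current solution `A`,
draw `s` elements independently and uniformly at random (with repetition) from
`V \ A` (modeled as the uniform = product-of-uniforms pmf on
`Fin s → {x // x ∈ univ \ A}`), and insert the sampled element chosen by the
selection rule `sel` (an argmax of the marginal gain over the sample).  If `A`
is already the whole ground set (which never happens during the first
`k ≤ |V|` steps), the step keeps `A` unchanged. -/
noncomputable def sgStep {V : Type*} [Fintype V] [DecidableEq V]
    (s : ℕ) (sel : Finset V → (Fin s → V) → V) (A : Finset V) :
    PMF (Finset V) :=
  if h : (Finset.univ \ A).Nonempty then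
    haveI : Nonempty {x // x ∈ Finset.univ \ A} := ⟨⟨h.choose, h.choose_spec⟩⟩
    (PMF.uniformOfFintype (Fin s → {x // x ∈ Finset.univ \ A})).map
      (fun r => insert (sel A (fun i => (r i : V))) A)
  else PMF.pure A

/-- The Stochastic-Greedy process after `i` steps, as a pmf over sets:
`A₀ = ∅` and `A_i` is obtained from `A_{i-1}` by one stochastic-greedy step. -/
noncomputable def sgProc {V : Type*} [Fintype V] [DecidableEq V]
    (s : ℕ) (sel : Finset V → (Fin s → V) → V) : ℕ → PMF (Finset V)
  | 0 => PMF.pure ∅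
  | i + 1 => (sgProc s sel i).bind (sgStep s sel)

/-- If `G r` dominates `D` at every entry of the tuple `r`, then its total over all tuples is at least
the average of `D` over `B` times the number of tuples that meet `B`. -/
theorem sum_mul_hitting_le_card_mul_sum {W : Type*} [Fintype W] [DecidableEq W] (B : Finset W)
    (D : W → ℝ) (s : ℕ) (G : (Fin s → W) → ℝ) (hG0 : ∀ r, 0 ≤ G r) (hG : ∀ r i, D (r i) ≤ G r) :
    (∑ a ∈ B, D a) * ((Fintype.card W : ℝ) ^ s - ((Fintype.card W : ℝ) - #B) ^ s)
      ≤ #B * ∑ r, G r := by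
  induction s with
  | zero =>
    simpa using mul_nonneg (Nat.cast_nonneg (#B)) (hG0 default)
  | succ s ih =>
    have hsplit : ∑ r, G r = ∑ x, ∑ r : Fin s → W, G (Fin.cons x r) := by
      rw [← Fintype.sum_prod_type']
      exact (Equiv.sum_comp (Fin.consEquiv fun _ => W) G).symm
    have hhit : ∀ x, (Fintype.card W : ℝ) ^ s * D x ≤ ∑ r : Fin s → W, G (Fin.cons x r) := by
      intro x
      calc (Fintype.card W : ℝ) ^ s * D x = ∑ _r : Fin s → W, D x := by simp
        _ ≤ _ := sum_le_sum fun r _ => by simpa using hG (Fin.cons x r) 0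
    have hmiss : ∀ x, (∑ a ∈ B, D a) *
        ((Fintype.card W : ℝ) ^ s - ((Fintype.card W : ℝ) - #B) ^ s)
          ≤ #B * ∑ r : Fin s → W, G (Fin.cons x r) := fun x =>
      ih (fun r => G (Fin.cons x r)) (fun r => hG0 _)
        (fun r i => by simpa using hG (Fin.cons x r) i.succ)
    have hcompl : ((#Bᶜ : ℕ) : ℝ) = Fintype.card W - #B := by
      rw [card_compl, Nat.cast_sub (card_le_univ B)]
    have hB : #B * ((Fintype.card W : ℝ) ^ s * ∑ a ∈ B, D a)
        ≤ #B * ∑ x ∈ B, ∑ r : Fin s → W, G (Fin.cons x r) := by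
      rw [mul_sum _ _ ((Fintype.card W : ℝ) ^ s)]
      gcongr with x
      exact hhit x
    have hBc := sum_le_sum fun x (_ : x ∈ Bᶜ) => hmiss x
    rw [sum_const, nsmul_eq_mul, hcompl, ← mul_sum] at hBc
    rw [hsplit, ← sum_add_sum_compl B, mul_add, pow_succ, pow_succ]
    linarith

theorem sub_le_sum_marginal_sdiff {V : Type*} [DecidableEq V] (f : Finset V → ℝ)
    (hmono : ∀ A B : Finset V, A ⊆ B → f A ≤ f B)
    (hsub : ∀ A B : Finset V, A ⊆ B → ∀ i ∉ B,
      f (insert i B) - f B ≤ f (insert i A) - f A) (A S : Finset V) :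
    f S - f A ≤ ∑ a ∈ S \ A, (f (insert a A) - f A) := by
  have key : ∀ T : Finset V, Disjoint T A →
      f (T ∪ A) - f A ≤ ∑ a ∈ T, (f (insert a A) - f A) := by
    intro T
    induction T using Finset.induction_on with
    | empty => simp
    | insert a T ha ih =>
      intro hT
      rw [disjoint_insert_left] at hT
      have h := hsub A (T ∪ A) subset_union_right a (by simp [ha, hT.1])
      rw [sum_insert ha, insert_union]
      linarith [ih hT.2]
  have h := key (S \ A) sdiff_disjoint
  rw [sdiff_union_self_eq_union] at h
  linarith [hmono S (S ∪ A) subset_union_left]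

theorem PMF.sum_bind_toReal_mul {α β : Type*} [Fintype α] [Fintype β] (p : PMF α)
    (q : α → PMF β) (f : β → ℝ) :
    ∑ b, ((p.bind q) b).toReal * f b = ∑ a, (p a).toReal * ∑ b, (q a b).toReal * f b := by
  simp_rw [PMF.bind_apply, tsum_fintype, mul_sum]
  rw [sum_comm]
  refine sum_congr rfl fun b _ => ?_
  rw [ENNReal.toReal_sum fun a _ => ENNReal.mul_ne_top (p.apply_ne_top a) ((q a).apply_ne_top b),
    sum_mul]
  simp [mul_assoc]

theorem PMF.sum_pure_toReal_mul {α : Type*} [Fintype α] (a : α) (f : α → ℝ) :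
    ∑ b, ((PMF.pure a) b).toReal * f b = f a := by
  classical
  rw [Finset.sum_eq_single a] <;> simp +contextual [PMF.pure_apply]

theorem PMF.sum_toReal {α : Type*} [Fintype α] (p : PMF α) : ∑ a, (p a).toReal = 1 := by
  rw [← ENNReal.toReal_sum fun a _ => p.apply_ne_top a, ← tsum_fintype (L := .unconditional α),
    p.tsum_coe, ENNReal.toReal_one]

theorem Real.exp_mul_le_one_sub_add_mul_exp {t : ℝ} (ht0 : 0 ≤ t) (ht1 : t ≤ 1) (x : ℝ) :
    Real.exp (t * x) ≤ 1 - t + t * Real.exp x := by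
  simpa using convexOn_exp.2 (Set.mem_univ 0) (Set.mem_univ x) (sub_nonneg.2 ht1) ht0 (by ring)

/-- A sample of size at least `(n / k) * log (1 / ε)` drawn from `m ≤ n` elements hits a fixed set of
`b ≤ k` of them with probability at least `(1 - ε) * b / k`. -/
theorem one_sub_div_pow_le {n k m b ε : ℝ} {s : ℕ} (hk : 0 < k) (hm : 0 < m) (hmn : m ≤ n)
    (hb : 0 ≤ b) (hbm : b ≤ m) (hbk : b ≤ k) (hε : 0 < ε)
    (hs : n / k * Real.log (1 / ε) ≤ s) :
    (1 - b / m) ^ s ≤ 1 - (1 - ε) * (b / k) := by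
  have hn : 0 < n := hm.trans_le hmn
  have h1 : 1 - b / m ≤ Real.exp (-(b / n)) := by
    have := Real.one_sub_le_exp_neg (b / n)
    have : b / n ≤ b / m := by gcongr
    linarith
  have h0 : 0 ≤ 1 - b / m := sub_nonneg.2 ((div_le_one hm).2 hbm)
  have hexp : (s : ℝ) * -(b / n) ≤ b / k * Real.log ε := by
    have h := mul_le_mul_of_nonneg_left hs (div_nonneg hb hn.le)
    have e : b / n * (n / k * Real.log (1 / ε)) = -(b / k * Real.log ε) := by
      rw [one_div, Real.log_inv]
      field_simp
    linarith
  calc (1 - b / m) ^ s ≤ Real.exp (-(b / n)) ^ s := by gcongr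
    _ = Real.exp (s * -(b / n)) := (Real.exp_nat_mul _ _).symm
    _ ≤ Real.exp (b / k * Real.log ε) := Real.exp_le_exp.2 hexp
    _ ≤ 1 - b / k + b / k * Real.exp (Real.log ε) :=
      Real.exp_mul_le_one_sub_add_mul_exp (by positivity) ((div_le_one hk).2 hbk) _
    _ = 1 - (1 - ε) * (b / k) := by rw [Real.exp_log hε]; ring

theorem add_mul_le_expect_sgStep {V : Type*} [Fintype V] [DecidableEq V] (f : Finset V → ℝ)
    (hmono : ∀ A B : Finset V, A ⊆ B → f A ≤ f B)
    (hsub : ∀ A B : Finset V, A ⊆ B → ∀ i ∉ B,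
      f (insert i B) - f B ≤ f (insert i A) - f A)
    {k s : ℕ} (hk : 0 < k) {ε : ℝ} (hε0 : 0 < ε) (hε1 : ε < 1)
    (hs : (Fintype.card V : ℝ) / k * Real.log (1 / ε) ≤ s)
    (sel : Finset V → (Fin s → V) → V)
    (hsel : ∀ (A : Finset V) (r : Fin s → V) (i : Fin s),
      f (insert (r i) A) - f A ≤ f (insert (sel A r) A) - f A)
    (S : Finset V) (hS : #S ≤ k) (A : Finset V) :
    f A + (1 - ε) / k * (f S - f A) ≤ ∑ A', (sgStep s sel A A').toReal * f A' := by
  have hk' : (0 : ℝ) < k := by exact_mod_cast hk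
  have hc : 0 ≤ (1 - ε) / k := div_nonneg (by linarith) hk'.le
  unfold sgStep
  split_ifs with h
  · have : Nonempty {x // x ∈ univ \ A} := ⟨⟨h.choose, h.choose_spec⟩⟩
    set W := {x // x ∈ univ \ A}
    set B : Finset W := univ.filter fun x => (x : V) ∈ S with hB
    set D : W → ℝ := fun x => f (insert (x : V) A) - f A with hD
    set G : (Fin s → W) → ℝ := fun r => f (insert (sel A fun i => (r i : V)) A) - f A with hG
    have hmap : B.map (Function.Embedding.subtype _) = S \ A := by
      ext x
      simp [hB, and_comm]
    have hcardB : #B = #(S \ A) := by rw [← hmap, card_map]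
    have hbk : (#B : ℝ) ≤ k := by
      exact_mod_cast (hcardB.trans_le (card_le_card sdiff_subset)).trans hS
    have hsumD : ∑ a ∈ B, D a = ∑ a ∈ S \ A, (f (insert a A) - f A) := by
      rw [← hmap, sum_map]; rfl
    have hgain : f S - f A ≤ ∑ a ∈ B, D a :=
      (sub_le_sum_marginal_sdiff f hmono hsub A S).trans_eq hsumD.symm
    have hG0 : ∀ r, 0 ≤ G r := fun r => sub_nonneg.2 (hmono _ _ (subset_insert _ _))
    have hD0 : 0 ≤ ∑ a ∈ B, D a :=
      sum_nonneg fun a _ => sub_nonneg.2 (hmono _ _ (subset_insert _ _))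
    have hm : (0 : ℝ) < Fintype.card W := by exact_mod_cast Fintype.card_pos
    have hmn : (Fintype.card W : ℝ) ≤ Fintype.card V := by
      exact_mod_cast Fintype.card_subtype_le _
    have hbm : (#B : ℝ) ≤ Fintype.card W := by exact_mod_cast card_le_univ B
    have hmain := sum_mul_hitting_le_card_mul_sum B D s G hG0
      fun r i => hsel A (fun j => (r j : V)) i
    have hE : ∑ A', ((PMF.uniformOfFintype (Fin s → W)).map
        (fun r => insert (sel A fun i => (r i : V)) A) A').toReal * f A'
          = f A + (∑ r, G r) / (Fintype.card W : ℝ) ^ s := by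
      rw [PMF.map, PMF.sum_bind_toReal_mul]
      simp only [Function.comp_apply, PMF.sum_pure_toReal_mul, PMF.uniformOfFintype_apply, hG,
        sum_sub_distrib, ← mul_sum]
      simp
      field_simp
      ring
    refine le_of_le_of_eq ?_ (hE.symm.trans (by congr!))
    gcongr
    rcases (Nat.cast_nonneg (α := ℝ) #B).eq_or_lt with hb | hb
    · have hB0 : B = ∅ := by
        rw [← card_eq_zero]; exact_mod_cast hb.symm
      rw [hB0, sum_empty] at hgain
      exact (mul_nonpos_of_nonneg_of_nonpos hc hgain).trans
        (div_nonneg (sum_nonneg fun r _ => hG0 r) (by positivity))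
    · have hprob := one_sub_div_pow_le hk' hm hmn hb.le hbm hbk hε0 hs
      have hpow : (1 - (#B : ℝ) / Fintype.card W) ^ s
          = ((Fintype.card W : ℝ) - #B) ^ s / (Fintype.card W : ℝ) ^ s := by
        rw [← div_pow, sub_div, div_self hm.ne']
      rw [hpow, div_le_iff₀ (by positivity)] at hprob
      calc (1 - ε) / k * (f S - f A) ≤ (1 - ε) / k * ∑ a ∈ B, D a := by gcongr
        _ ≤ (∑ r, G r) / (Fintype.card W : ℝ) ^ s := by
          rw [le_div_iff₀ (by positivity)]
          refine le_of_mul_le_mul_left ?_ hb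
          refine le_trans ?_ hmain
          have := mul_le_mul_of_nonneg_left hprob hD0
          have e : (#B : ℝ) * ((1 - ε) / k * (∑ a ∈ B, D a) * (Fintype.card W : ℝ) ^ s)
              = (∑ a ∈ B, D a) * ((1 - ε) * (#B / k) * (Fintype.card W : ℝ) ^ s) := by ring
          linarith
  · have hA : A = univ := by
      rw [not_nonempty_iff_eq_empty, sdiff_eq_empty_iff_subset] at h
      exact univ_subset_iff.1 h
    rw [PMF.sum_pure_toReal_mul]
    have : f S ≤ f A := hmono _ _ (hA ▸ subset_univ S)
    linarith [mul_nonpos_of_nonneg_of_nonpos hc (sub_nonpos.2 this)]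

/-- **Stochastic-Greedy guarantee.**  Let `f` be a non-negative monotone
submodular function on a ground set `V` of size `n`, let `1 ≤ k ≤ n`,
`ε ∈ (0,1)` and `s = ⌈(n/k)·log(1/ε)⌉`.  Run Stochastic-Greedy for `k` steps,
where at each step a multiset of `s` elements is sampled independently and
uniformly at random (with repetition) from `V \ A_{i-1}` and an element of the
sample maximizing the marginal gain `Δ(·|A_{i-1})` (as certified by the
hypothesis on the selection rule `sel`) is added.  Then
`E[f(A_k)] ≥ (1 − 1/e − ε) · f(A*)` for any maximizer `A*` of `f` among sets
of cardinality at most `k`. -/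
theorem stochastic_greedy_guarantee
    {V : Type*} [Fintype V] [DecidableEq V]
    (f : Finset V → ℝ)
    (hf0 : ∀ A : Finset V, 0 ≤ f A)
    (hmono : ∀ A B : Finset V, A ⊆ B → f A ≤ f B)
    (hsub : ∀ A B : Finset V, A ⊆ B → ∀ i ∉ B,
      f (insert i B) - f B ≤ f (insert i A) - f A)
    (n k s : ℕ) (hn : Fintype.card V = n) (hk : 1 ≤ k) (hkn : k ≤ n)
    (ε : ℝ) (hε0 : 0 < ε) (hε1 : ε < 1)
    (hs : s = ⌈((n : ℝ) / k) * Real.log (1 / ε)⌉₊)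
    (sel : Finset V → (Fin s → V) → V)
    (hsel : ∀ (A : Finset V) (r : Fin s → V),
      (∃ i : Fin s, sel A r = r i) ∧
        ∀ i : Fin s, f (insert (r i) A) - f A ≤ f (insert (sel A r) A) - f A)
    (Astar : Finset V) (hcard : Astar.card ≤ k)
    (hopt : ∀ B : Finset V, B.card ≤ k → f B ≤ f Astar) :
    (1 - 1 / Real.exp 1 - ε) * f Astar
      ≤ ∑ A : Finset V, ((sgProc s sel k) A).toReal * f A := by
  have hk0 : (0 : ℝ) < k := by exact_mod_cast hk
  have hk1 : (1 : ℝ) ≤ k := by exact_mod_cast hk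
  have hs' : (Fintype.card V : ℝ) / k * Real.log (1 / ε) ≤ s := by
    rw [hs, hn]
    exact Nat.le_ceil _
  set c : ℝ := (1 - ε) / k with hc
  have hc1 : 0 ≤ 1 - c := by
    rw [sub_nonneg, hc, div_le_one hk0]
    linarith
  have hstep := add_mul_le_expect_sgStep f hmono hsub hk hε0 hε1 hs' sel
    (fun A r => (hsel A r).2) Astar hcard
  have hproc : ∀ i, f Astar - ∑ A, (sgProc s sel i A).toReal * f A ≤ (1 - c) ^ i * f Astar := by
    intro i
    induction i with
    | zero =>
      rw [sgProc, PMF.sum_pure_toReal_mul]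
      linarith [hf0 ∅]
    | succ i ih =>
      have hle : ∑ A, (sgProc s sel i A).toReal * (f A + c * (f Astar - f A))
          ≤ ∑ A, (sgProc s sel (i + 1) A).toReal * f A := by
        rw [sgProc, PMF.sum_bind_toReal_mul]
        gcongr with A
        exact hstep A
      have heq : ∑ A, (sgProc s sel i A).toReal * (f A + c * (f Astar - f A))
          = (1 - c) * ∑ A, (sgProc s sel i A).toReal * f A + c * f Astar := by
        calc _ = ∑ A, ((1 - c) * ((sgProc s sel i A).toReal * f A)
              + (sgProc s sel i A).toReal * (c * f Astar)) :=
              sum_congr rfl fun A _ => by ring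
          _ = _ := by
            rw [sum_add_distrib, ← mul_sum, ← sum_mul, PMF.sum_toReal, one_mul]
      have := mul_le_mul_of_nonneg_left ih hc1
      rw [pow_succ]
      linarith
  have hpow : (1 - c) ^ k ≤ 1 / Real.exp 1 + ε := by
    calc (1 - c) ^ k ≤ Real.exp (-c) ^ k := by
          gcongr
          exact Real.one_sub_le_exp_neg c
      _ = Real.exp ((1 - ε) * -1) := by
          rw [← Real.exp_nat_mul, hc]
          congr 1
          field_simp
      _ ≤ 1 - (1 - ε) + (1 - ε) * Real.exp (-1) :=
          Real.exp_mul_le_one_sub_add_mul_exp (by linarith) (by linarith) _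
      _ ≤ 1 / Real.exp 1 + ε := by
          rw [one_div, ← Real.exp_neg]
          linarith [mul_pos hε0 (Real.exp_pos (-1))]
  have := mul_le_mul_of_nonneg_right hpow (hf0 Astar)
  linarith [hproc k]
end

section
/- Let V be a finite ground set of size n, let f : Finset V → ℝ be a non-negative monotone submodular set function, let k ≥ 1 with k ≤ n, let ε ∈ (0,1), and let s = ⌈(n/k)·log(1/ε)⌉. Fix a current solution A ⊊ V and any set A* ⊆ V with |A*| ≤ k. Let R be a multiset of s elements sampled independently and uniformly at random (with repetition) from V \ A, and let a ∈ R be an element of R maximizing the marginal gain Δ(a|A) = f(A ∪ {a}) − f(A). Then E[Δ(a|A)] ≥ ((1 − ε)/k) · Σ_{a ∈ A* \ A} Δ(a|A). -/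
open Finset

/-- The pmf of `s` independent uniform samples (with repetition) from a
nonempty finset `W`; each coordinate is uniform on `W`, and the product of
uniforms is the uniform pmf on `Fin s → {x // x ∈ W}`. -/
noncomputable def uniformSample {V : Type*} [DecidableEq V]
    (s : ℕ) (W : Finset V) (h : W.Nonempty) :
    PMF (Fin s → {x // x ∈ W}) :=
  haveI : Nonempty {x // x ∈ W} := ⟨⟨h.choose, h.choose_spec⟩⟩
  PMF.uniformOfFintype _

/-- If `g ≥ 0` and `T` is a set of points of `α`, then the maximum of `g` over `s` points of `α`,
summed over all choices of these points, is at least the number of choices meeting `T` times the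
average of `g` over `T`. -/
theorem card_hits_mul_sum_le {α : Type*} [Fintype α] [DecidableEq α]
    (g : α → ℝ) (hg : ∀ a, 0 ≤ g a) (T : Finset α) (s : ℕ) :
    ((Fintype.card α : ℝ) ^ s - ((Fintype.card α : ℝ) - #T) ^ s) * ∑ a ∈ T, g a
      ≤ #T * ∑ r : Fin s → α, ⨆ i, g (r i) := by
  induction s with
  | zero => simp
  | succ s ih =>
    have hsplit : ∑ a, ∑ r : Fin s → α, (if a ∈ T then g a else ⨆ i, g (r i))
        ≤ ∑ r : Fin (s + 1) → α, ⨆ i, g (r i) := by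
      rw [← (Fin.consEquiv fun _ : Fin (s + 1) => α).sum_comp, Fintype.sum_prod_type]
      refine sum_le_sum fun a _ => sum_le_sum fun r _ => ?_
      have hle : ∀ j : Fin (s + 1), g ((Fin.cons a r : Fin (s + 1) → α) j)
          ≤ ⨆ i, g ((Fin.cons a r : Fin (s + 1) → α) i) :=
        fun j => le_ciSup (f := fun i => g ((Fin.cons a r : Fin (s + 1) → α) i))
          (Set.finite_range _).bddAbove j
      split_ifs
      · simpa using hle 0
      · refine Real.iSup_le (fun i => ?_) (Real.iSup_nonneg fun i => hg _)
        simpa using hle i.succ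
    have hcount : ∑ a, ∑ r : Fin s → α, (if a ∈ T then g a else ⨆ i, g (r i))
        = (Fintype.card α : ℝ) ^ s * ∑ a ∈ T, g a
          + ((Fintype.card α : ℝ) - #T) * ∑ r : Fin s → α, ⨆ i, g (r i) := by
      rw [← sum_add_sum_compl T]
      congr 1
      · rw [mul_sum]
        refine sum_congr rfl fun a ha => ?_
        simp [ha]
      · rw [sum_congr rfl fun a ha => sum_congr rfl fun r _ => if_neg (mem_compl.mp ha)]
        rw [sum_const, nsmul_eq_mul, card_compl, Nat.cast_sub (card_le_univ T)]
    rw [hcount] at hsplit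
    have hT : (#T : ℝ) ≤ Fintype.card α := by exact_mod_cast card_le_univ T
    have h1 := mul_le_mul_of_nonneg_left ih (sub_nonneg.mpr hT)
    have h2 := mul_le_mul_of_nonneg_left hsplit (Nat.cast_nonneg (α := ℝ) #T)
    rw [pow_succ, pow_succ]
    linarith

/-- With `s ≥ (n / k) * log (1 / ε)` samples from `m ≤ n` points, a set of `t ≤ k` points is hit
with probability at least `(t / k) * (1 - ε)`. -/
theorem mul_one_sub_le_hit_probability {t m k n ε : ℝ} {s : ℕ} (ht : 0 ≤ t) (htm : t ≤ m)
    (htk : t ≤ k) (hm : 0 < m) (hmn : m ≤ n) (hk : 0 < k) (hε : 0 < ε)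
    (hs : n / k * Real.log (1 / ε) ≤ s) :
    t / k * (1 - ε) ≤ 1 - (1 - t / m) ^ s := by
  have hn : 0 < n := hm.trans_le hmn
  have hexp : Real.exp (-(s * k / n)) ≤ ε := by
    rw [← Real.le_log_iff_exp_le hε]
    have : Real.log (1 / ε) ≤ s * k / n := by
      rw [le_div_iff₀ hn]
      calc Real.log (1 / ε) * n = n / k * Real.log (1 / ε) * k := by field_simp
        _ ≤ s * k := by gcongr
    rw [one_div, Real.log_inv] at this
    linarith
  have hconv : Real.exp (-(s * t / n)) ≤ 1 - t / k + t / k * Real.exp (-(s * k / n)) := by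
    have hle : t / k ≤ 1 := (div_le_one hk).mpr htk
    have := convexOn_exp.2 (Set.mem_univ 0) (Set.mem_univ (-(s * k / n)))
      (sub_nonneg.mpr hle) (div_nonneg ht hk.le) (sub_add_cancel 1 (t / k))
    simp only [smul_eq_mul, mul_zero, zero_add, Real.exp_zero, mul_one] at this
    rwa [show t / k * -(s * k / n) = -(s * t / n) by field_simp] at this
  have hpow : (1 - t / m) ^ s ≤ Real.exp (-(s * t / n)) :=
    calc (1 - t / m) ^ s ≤ Real.exp (-(t / m)) ^ s :=
          pow_le_pow_left₀ (sub_nonneg.mpr ((div_le_one hm).mpr htm)) (Real.one_sub_le_exp_neg _) s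
      _ = Real.exp (-(s * t / m)) := by rw [← Real.exp_nat_mul]; congr 1; ring
      _ ≤ Real.exp (-(s * t / n)) := by gcongr
  have := mul_le_mul_of_nonneg_left hexp (div_nonneg ht hk.le)
  linarith

/-- One step of Stochastic-Greedy: for a non-negative monotone submodular `f`
on a ground set `V` of size `n`, a current solution `A ⊊ V`, any `A* ⊆ V` with
`|A*| ≤ k` (`1 ≤ k ≤ n`), `ε ∈ (0,1)` and `s = ⌈(n/k)·log(1/ε)⌉`, the expected
largest marginal gain `Δ(a|A)` over a sample `R` of `s` elements drawn
independently and uniformly (with repetition) from `V \ A` satisfies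
`E[Δ(a|A)] ≥ ((1−ε)/k) · Σ_{a ∈ A* \ A} Δ(a|A)`. -/
theorem stochastic_greedy_step_gain
    {V : Type*} [Fintype V] [DecidableEq V]
    (f : Finset V → ℝ)
    (hf0 : ∀ A : Finset V, 0 ≤ f A)
    (hmono : ∀ A B : Finset V, A ⊆ B → f A ≤ f B)
    (hsub : ∀ A B : Finset V, A ⊆ B → ∀ i ∉ B,
      f (insert i B) - f B ≤ f (insert i A) - f A)
    (n k s : ℕ) (hn : Fintype.card V = n) (hk : 1 ≤ k) (hkn : k ≤ n)
    (ε : ℝ) (hε0 : 0 < ε) (hε1 : ε < 1)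
    (hs : s = ⌈((n : ℝ) / k) * Real.log (1 / ε)⌉₊)
    (A : Finset V) (hA : A ⊂ Finset.univ)
    (Astar : Finset V) (hcard : Astar.card ≤ k) :
    ((1 - ε) / k) * ∑ a ∈ Astar \ A, (f (insert a A) - f A)
      ≤ ∑ r : Fin s → {x // x ∈ Finset.univ \ A},
          ((uniformSample s (Finset.univ \ A)
              (Finset.sdiff_nonempty.mpr hA.2)) r).toReal
            * ⨆ i : Fin s, (f (insert ((r i : V)) A) - f A) := by
  classical
  have hW : (Finset.univ \ A).Nonempty := Finset.sdiff_nonempty.mpr hA.2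
  set g : {x // x ∈ Finset.univ \ A} → ℝ := fun x => f (insert (x : V) A) - f A with hgdef
  have hg : ∀ x, 0 ≤ g x := fun x => sub_nonneg.mpr (hmono _ _ (subset_insert _ _))
  set T : Finset {x // x ∈ Finset.univ \ A} := Astar.subtype _ with hT
  have hmap : T.map (Function.Embedding.subtype _) = Astar \ A := by
    ext x
    simp [hT, and_comm]
  have hsum : ∑ a ∈ Astar \ A, (f (insert a A) - f A) = ∑ x ∈ T, g x := by
    rw [← hmap, sum_map]
    rfl
  have hTk : (#T : ℝ) ≤ k := by
    rw [← card_map (Function.Embedding.subtype _), hmap]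
    exact_mod_cast (card_le_card sdiff_subset).trans hcard
  set m : ℕ := #(Finset.univ \ A) with hmdef
  have hmcard (inst : Fintype {x // x ∈ Finset.univ \ A}) : @Fintype.card _ inst = m :=
    @Fintype.card_of_subtype _ _ _ (fun _ => Iff.rfl) inst
  have hm : (0 : ℝ) < m := by exact_mod_cast hW.card_pos
  have hmn : (m : ℝ) ≤ n := by
    rw [hmdef, ← hn]
    exact_mod_cast card_le_univ _
  have hTm : (#T : ℝ) ≤ m := by
    exact_mod_cast (card_le_univ T).trans_eq (hmcard _)
  have hk0 : (0 : ℝ) < k := by exact_mod_cast hk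
  have hweight : ∀ r, (uniformSample s (Finset.univ \ A) hW r).toReal = ((m : ℝ) ^ s)⁻¹ := by
    intro r
    simp only [uniformSample, PMF.uniformOfFintype_apply, Fintype.card_fun, Fintype.card_fin, hmcard,
      Nat.cast_pow, ENNReal.toReal_inv, ENNReal.toReal_pow, ENNReal.toReal_natCast]
  simp only [hweight]
  rw [← mul_sum, hsum]
  change _ ≤ ((m : ℝ) ^ s)⁻¹ * ∑ r : Fin s → {x // x ∈ Finset.univ \ A}, ⨆ i, g (r i)
  rcases T.eq_empty_or_nonempty with hempty | hne
  · rw [hempty, sum_empty, mul_zero]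
    exact mul_nonneg (by positivity)
      (sum_nonneg fun r _ => Real.iSup_nonneg fun i => hg _)
  have ht : (0 : ℝ) < #T := by exact_mod_cast hne.card_pos
  have hhit := mul_one_sub_le_hit_probability (s := s) ht.le hTm hTk hm hmn hk0 hε0
    (hs ▸ Nat.le_ceil _)
  have hcount := card_hits_mul_sum_le g hg T s
  have hpow : (m : ℝ) ^ s - (m - #T) ^ s = m ^ s * (1 - (1 - #T / m) ^ s) := by
    rw [mul_sub, ← mul_pow, mul_sub, mul_one, mul_one, mul_div_cancel₀ _ hm.ne']
  rw [hmcard, hpow] at hcount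
  have hS : 0 ≤ ∑ x ∈ T, g x := sum_nonneg fun x _ => hg x
  have hms : (0 : ℝ) < (m : ℝ) ^ s := by positivity
  rw [le_inv_mul_iff₀ hms]
  refine le_of_mul_le_mul_left ?_ ht
  calc (#T : ℝ) * (m ^ s * ((1 - ε) / k * ∑ x ∈ T, g x))
      = m ^ s * (#T / k * (1 - ε)) * ∑ x ∈ T, g x := by ring
    _ ≤ m ^ s * (1 - (1 - #T / m) ^ s) * ∑ x ∈ T, g x := by gcongr
    _ ≤ _ := by convert hcount
end

section
/- Let V be a finite ground set of size n, let A ⊊ V, let A* ⊆ V with |A*| ≤ k for some integer k ≥ 1, let ε ∈ (0,1), and let s = ⌈(n/k)·log(1/ε)⌉. If R consists of s elements sampled independently and uniformly at random (with repetition) from V \ A, then the probability that R contains at least one element of A* \ A is at least (1 − ε)·|A* \ A|/k. -/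
open Finset

/-- The number of `s`-tuples with no coordinate satisfying `p` is the `s`-th power of the number
of elements not satisfying `p`; the remaining tuples have some coordinate satisfying `p`. -/
lemma card_filter_exists_add_card_pow {β : Type*} [Fintype β] (p : β → Prop) [DecidablePred p]
    (s : ℕ) [DecidablePred fun r : Fin s → β => ∃ i, p (r i)] :
    #{r : Fin s → β | ∃ i, p (r i)} + #{b : β | ¬ p b} ^ s = Fintype.card β ^ s := by
  classical
  have h : (univ.filter fun r : Fin s → β => ¬ ∃ i, p (r i)) =
      Fintype.piFinset fun _ => univ.filter fun b : β => ¬ p b := by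
    ext r
    simp [Fintype.mem_piFinset]
  have h' := Finset.card_filter_add_card_filter_not (s := (univ : Finset (Fin s → β)))
    (fun r => ∃ i, p (r i))
  rw [h, Fintype.card_piFinset_const] at h'
  simpa using h'

/-- The probability that `s` independent uniform samples from `W` hit `T ⊆ W` is
`1 - (1 - |T| / |W|) ^ s`. -/
lemma uniformSample_hit {V : Type*} [DecidableEq V] (s : ℕ) {W T : Finset V} (h : W.Nonempty)
    (hT : T ⊆ W) :
    (uniformSample s W h).toOuterMeasure {r | ∃ i : Fin s, (r i : V) ∈ T} =
      ENNReal.ofReal (1 - (1 - (#T : ℝ) / #W) ^ s) := by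
  classical
  have hW : (0 : ℝ) < #W := by exact_mod_cast h.card_pos
  have hcompl : (#{b : {x // x ∈ W} | ¬ (b : V) ∈ T} : ℝ) = #W - #T := by
    have h1 : #{b : {x // x ∈ W} | ¬ (b : V) ∈ T} = #(W \ T) := by
      rw [← Finset.card_map (Function.Embedding.subtype _)]
      congr 1
      ext x
      simp [and_comm]
    rw [h1, Finset.card_sdiff_of_subset hT, Nat.cast_sub (Finset.card_le_card hT)]
  have hcard := card_filter_exists_add_card_pow (fun b : {x // x ∈ W} => (b : V) ∈ T) s
  have hcardR : (#{r : Fin s → {x // x ∈ W} | ∃ i, (r i : V) ∈ T} : ℝ) =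
      (#W : ℝ) ^ s - (#W - #T : ℝ) ^ s := by
    rw [← hcompl, eq_sub_iff_add_eq]
    rw [Fintype.card_coe] at hcard
    exact_mod_cast hcard
  have hval : 1 - (1 - (#T : ℝ) / #W) ^ s =
      (#{r : Fin s → {x // x ∈ W} | ∃ i, (r i : V) ∈ T} : ℝ) / ((#W ^ s : ℕ) : ℝ) := by
    rw [hcardR, one_sub_div hW.ne', div_pow, Nat.cast_pow, sub_div, div_self (pow_pos hW s).ne']
  have : Nonempty {x // x ∈ W} := h.to_subtype
  rw [hval, ENNReal.ofReal_div_of_pos (by exact_mod_cast pow_pos h.card_pos s),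
    ENNReal.ofReal_natCast, ENNReal.ofReal_natCast, uniformSample,
    PMF.toOuterMeasure_uniformOfFintype_apply, Fintype.card_fun, Fintype.card_coe,
    Fintype.card_fin, ← Fintype.card_subtype]
  rfl

/-- If `s ≥ (n / k) log (1 / ε)`, then missing a set of size `t ≤ k` inside a set of size `m ≤ n`
in `s` uniform draws has probability at most `1 - (1 - ε) t / k`. -/
lemma one_sub_div_pow_le_one_sub_mul_div {n m k t ε : ℝ} {s : ℕ} (hm : 0 < m) (hmn : m ≤ n)
    (hk : 0 < k) (ht : 0 ≤ t) (htm : t ≤ m) (htk : t ≤ k) (hε0 : 0 < ε) (hε1 : ε < 1)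
    (hs : n / k * Real.log (1 / ε) ≤ s) :
    (1 - t / m) ^ s ≤ 1 - (1 - ε) * t / k := by
  have hlog : 0 ≤ Real.log (1 / ε) := Real.log_nonneg (one_le_one_div hε0 hε1.le)
  have hexp : Real.log (1 / ε) * (t / k) ≤ s * (t / m) := calc
    Real.log (1 / ε) * (t / k) = m / k * Real.log (1 / ε) * (t / m) := by field_simp
    _ ≤ n / k * Real.log (1 / ε) * (t / m) := by gcongr
    _ ≤ s * (t / m) := by gcongr
  calc (1 - t / m) ^ s ≤ Real.exp (-(t / m)) ^ s :=
        pow_le_pow_left₀ (sub_nonneg.2 (div_le_one_of_le₀ htm hm.le))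
          (Real.one_sub_le_exp_neg _) s
    _ = Real.exp (-(s * (t / m))) := by rw [← Real.exp_nat_mul, mul_neg]
    _ ≤ Real.exp (-(Real.log (1 / ε) * (t / k))) := by gcongr
    _ = (1 + (ε - 1)) ^ (t / k) := by
        rw [add_sub_cancel, Real.rpow_def_of_pos hε0, one_div, Real.log_inv, neg_mul, neg_neg]
    _ ≤ 1 + t / k * (ε - 1) :=
        rpow_one_add_le_one_add_mul_self (by linarith) (by positivity)
          (div_le_one_of_le₀ htk hk.le)
    _ = 1 - (1 - ε) * t / k := by ring

/-- For `A ⊊ V`, `|A*| ≤ k`, `ε ∈ (0,1)` and `s = ⌈(n/k)·log(1/ε)⌉` where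
`n = |V|`, sampling `s` elements independently and uniformly (with repetition)
from `V \ A` hits `A* \ A` with probability at least `(1−ε)·|A* \ A|/k`. -/
theorem prob_hit_ge
    {V : Type*} [Fintype V] [DecidableEq V]
    (n k s : ℕ) (hn : Fintype.card V = n) (hk : 1 ≤ k)
    (ε : ℝ) (hε0 : 0 < ε) (hε1 : ε < 1)
    (hs : s = ⌈((n : ℝ) / k) * Real.log (1 / ε)⌉₊)
    (A : Finset V) (hA : A ⊂ Finset.univ)
    (Astar : Finset V) (hcard : Astar.card ≤ k) :
    ENNReal.ofReal ((1 - ε) * ((Astar \ A).card : ℝ) / k)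
      ≤ (uniformSample s (Finset.univ \ A)
            (Finset.sdiff_nonempty.mpr hA.2)).toOuterMeasure
          {r | ∃ i : Fin s, (r i : V) ∈ Astar \ A} := by
  have hT : Astar \ A ⊆ univ \ A := sdiff_subset_sdiff (subset_univ _) le_rfl
  have hW : (univ \ A).Nonempty := sdiff_nonempty.mpr hA.2
  rw [uniformSample_hit s hW hT]
  refine ENNReal.ofReal_le_ofReal (le_sub_comm.1 ?_)
  refine one_sub_div_pow_le_one_sub_mul_div (n := n) (by exact_mod_cast hW.card_pos) ?_
    (by exact_mod_cast hk) (by positivity) (by exact_mod_cast card_le_card hT) ?_ hε0 hε1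
    (hs ▸ Nat.le_ceil _)
  · rw [← hn]
    exact_mod_cast card_le_univ _
  · exact_mod_cast (card_le_card sdiff_subset).trans hcard
end

section
/- Let W be a nonempty finite set, let T ⊆ W be nonempty, and let g : W → ℝ be a non-negative function. If R consists of s elements sampled independently and uniformly at random (with repetition) from W, then E[max_{a ∈ R} g(a)] ≥ Pr[R ∩ T ≠ ∅] · (1/|T|) · Σ_{a ∈ T} g(a). (By exchangeability, conditioned on R ∩ T ≠ ∅, each element of T is equally likely to appear, so the maximum of g over R dominates the value of g at a uniformly random element of T when the intersection is nonempty.) -/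
open Finset

/-- The proportion of those coordinates of `r` lying in `T` that equal `a`. -/
noncomputable def hitWeight {ι W : Type*} [Fintype ι] [DecidableEq W]
    (T : Finset W) (r : ι → W) (a : W) : ℝ :=
  (#{i | r i = a} : ℝ) / #{i | r i ∈ T}

section HitWeight

variable {ι W : Type*} [Fintype ι] [DecidableEq W] {T : Finset W}

lemma hitWeight_nonneg (r : ι → W) (a : W) : 0 ≤ hitWeight T r a := by
  unfold hitWeight
  positivity

lemma sum_hitWeight (r : ι → W) :
    ∑ a ∈ T, hitWeight T r a = if ∃ i, r i ∈ T then 1 else 0 := by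
  have hcard : #{i | r i ∈ T} = ∑ a ∈ T, #{i | r i = a} := by
    rw [card_eq_sum_card_fiberwise (f := r) (t := T) (by intro i hi; simpa using hi)]
    refine sum_congr rfl fun a ha => ?_
    rw [filter_filter]
    congr 1
    ext i
    simp only [mem_filter, mem_univ, true_and, and_iff_right_iff_imp]
    rintro rfl
    exact ha
  simp only [hitWeight]
  rw [← sum_div, ← Nat.cast_sum, ← hcard]
  split_ifs with h
  · obtain ⟨i, hi⟩ := h
    have hpos : 0 < #{i | r i ∈ T} := card_pos.2 ⟨i, by simpa using hi⟩
    exact div_self (by exact_mod_cast hpos.ne')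
  · push Not at h
    simp [h]

lemma hitWeight_swap {a b : W} (ha : a ∈ T) (hb : b ∈ T) (r : ι → W) :
    hitWeight T (fun i => Equiv.swap a b (r i)) a = hitWeight T r b := by
  have hmem : ∀ x, Equiv.swap a b x ∈ T ↔ x ∈ T := by
    intro x
    rw [Equiv.swap_apply_def]
    split_ifs <;> simp_all
  simp [hitWeight, hmem, Equiv.swap_apply_eq_iff]

lemma sum_hitWeight_eq [DecidableEq ι] [Fintype W] {a b : W} (ha : a ∈ T) (hb : b ∈ T) :
    ∑ r : ι → W, hitWeight T r a = ∑ r : ι → W, hitWeight T r b := by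
  rw [← Equiv.sum_comp (Equiv.arrowCongr (Equiv.refl ι) (Equiv.swap a b))]
  exact sum_congr rfl fun r _ => hitWeight_swap ha hb r

lemma sum_hitWeight_mul_le_iSup {g : W → ℝ} (hg : ∀ a, 0 ≤ g a) (r : ι → W) :
    ∑ a ∈ T, hitWeight T r a * g a ≤ ⨆ i, g (r i) := by
  calc ∑ a ∈ T, hitWeight T r a * g a
      ≤ ∑ a ∈ T, hitWeight T r a * ⨆ i, g (r i) := by
        refine sum_le_sum fun a _ => ?_
        by_cases h : ∃ i, r i = a
        · obtain ⟨i, rfl⟩ := h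
          exact mul_le_mul_of_nonneg_left
            (le_ciSup (f := fun i => g (r i)) (Set.finite_range _).bddAbove i)
            (hitWeight_nonneg r _)
        · push Not at h
          simp [hitWeight, h]
    _ = (if ∃ i, r i ∈ T then 1 else 0) * ⨆ i, g (r i) := by
        rw [← sum_mul, sum_hitWeight]
    _ ≤ ⨆ i, g (r i) := by
        have h0 : 0 ≤ ⨆ i, g (r i) := Real.iSup_nonneg fun i => hg (r i)
        split_ifs <;> simp [h0]

lemma card_hit_mul_avg_le_sum_iSup [DecidableEq ι] [Fintype W] (hT : T.Nonempty)
    {g : W → ℝ} (hg : ∀ a, 0 ≤ g a) :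
    (#{r : ι → W | ∃ i, r i ∈ T} : ℝ) * ((1 / (T.card : ℝ)) * ∑ a ∈ T, g a)
      ≤ ∑ r : ι → W, ⨆ i, g (r i) := by
  obtain ⟨b, hb⟩ := hT
  have hT0 : (T.card : ℝ) ≠ 0 := by exact_mod_cast (card_pos.2 ⟨b, hb⟩).ne'
  have hcard : (#{r : ι → W | ∃ i, r i ∈ T} : ℝ)
      = T.card * ∑ r : ι → W, hitWeight T r b := by
    calc (#{r : ι → W | ∃ i, r i ∈ T} : ℝ)
        = ∑ r : ι → W, ∑ a ∈ T, hitWeight T r a := by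
          simp only [sum_hitWeight, sum_boole]
      _ = ∑ a ∈ T, ∑ r : ι → W, hitWeight T r b := by
          rw [sum_comm]
          exact sum_congr rfl fun a ha => sum_hitWeight_eq ha hb
      _ = T.card * ∑ r : ι → W, hitWeight T r b := by
          rw [sum_const, nsmul_eq_mul]
  calc (#{r : ι → W | ∃ i, r i ∈ T} : ℝ) * ((1 / (T.card : ℝ)) * ∑ a ∈ T, g a)
      = ∑ a ∈ T, (∑ r : ι → W, hitWeight T r b) * g a := by
        rw [hcard, ← mul_sum]
        field_simp
    _ = ∑ a ∈ T, (∑ r : ι → W, hitWeight T r a) * g a :=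
        sum_congr rfl fun a ha => by rw [sum_hitWeight_eq ha hb]
    _ = ∑ r : ι → W, ∑ a ∈ T, hitWeight T r a * g a := by
        simp only [sum_mul]
        exact sum_comm
    _ ≤ ∑ r : ι → W, ⨆ i, g (r i) :=
        sum_le_sum fun r _ => sum_hitWeight_mul_le_iSup hg r

end HitWeight

/-- Sample `s ≥ 1` elements independently and uniformly (with repetition) from a
nonempty finite set `W`, modeled as the uniform (= product of uniforms) pmf on
`Fin s → W`. For a non-negative `g : W → ℝ` and nonempty `T ⊆ W`, the expected
maximum of `g` over the sample is at least
`Pr[R ∩ T ≠ ∅] · (1/|T|) · Σ_{a ∈ T} g(a)`. -/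
theorem expected_max_ge_prob_hit_mul_avg
    {W : Type*} [Fintype W] [Nonempty W] [DecidableEq W]
    (T : Finset W) (hT : T.Nonempty)
    (g : W → ℝ) (hg : ∀ a, 0 ≤ g a)
    (s : ℕ) (hs : 0 < s) :
    ((PMF.uniformOfFintype (Fin s → W)).toOuterMeasure
          {r : Fin s → W | ∃ i : Fin s, r i ∈ T}).toReal
        * ((1 / (T.card : ℝ)) * ∑ a ∈ T, g a)
      ≤ ∑ r : Fin s → W,
          ((PMF.uniformOfFintype (Fin s → W)) r).toReal * ⨆ i : Fin s, g (r i) := by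
  classical
  rw [PMF.toOuterMeasure_uniformOfFintype_apply]
  simp only [PMF.uniformOfFintype_apply, ENNReal.toReal_div, ENNReal.toReal_inv,
    ENNReal.toReal_natCast]
  rw [← mul_sum, div_eq_inv_mul, mul_assoc]
  refine mul_le_mul_of_nonneg_left ?_ (by positivity)
  refine le_of_eq_of_le ?_ (card_hit_mul_avg_le_sum_iSup hT hg)
  congr 2
  rw [← Fintype.card_subtype]
  exact Fintype.card_congr (Equiv.refl _)
end

section
/- Let M ≥ 0, ε ∈ [0,1], and k ≥ 1 an integer, and let (x_i)_{i=0}^{k} be a sequence of real numbers with x₀ = 0 such that x_{i+1} − x_i ≥ ((1 − ε)/k)·(M − x_i) for all 0 ≤ i < k. Then x_k ≥ (1 − 1/e − ε)·M. -/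
/-- A sequence whose increments are at least `c * (M - x i)` closes the gap to `M` geometrically. -/
theorem sub_le_one_sub_pow_mul {c M : ℝ} (hc : c ≤ 1) {k : ℕ} {x : ℕ → ℝ}
    (hstep : ∀ i < k, c * (M - x i) ≤ x (i + 1) - x i) :
    M - x k ≤ (1 - c) ^ k * (M - x 0) := by
  induction k with
  | zero => simp
  | succ n ih =>
    have h := mul_le_mul_of_nonneg_left (ih fun i hi => hstep i (by omega)) (sub_nonneg.2 hc)
    have hn := hstep n n.lt_succ_self
    rw [pow_succ']
    linarith

theorem exp_neg_one_sub_le {ε : ℝ} (hε0 : 0 ≤ ε) (hε1 : ε ≤ 1) :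
    Real.exp (-(1 - ε)) ≤ 1 / Real.exp 1 + ε := by
  have h_split : 1 / Real.exp 1 = Real.exp (-(1 - ε)) * Real.exp (-ε) := by
    rw [← Real.exp_add, one_div, ← Real.exp_neg]
    ring_nf
  have h_tangent : 1 - ε ≤ Real.exp (-ε) := Real.one_sub_le_exp_neg ε
  have h_le_one : Real.exp (-(1 - ε)) ≤ 1 := Real.exp_le_one_iff.2 (by linarith)
  rw [h_split]
  nlinarith [Real.exp_pos (-(1 - ε))]

/-- Greedy recurrence with the stochastic-greedy rate: if `x₀ = 0` and
`x_{i+1} - x_i ≥ ((1-ε)/k)(M - x_i)` for all `i < k`, with `M ≥ 0`, `ε ∈ [0,1]`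
and `k ≥ 1` an integer, then `x_k ≥ (1 - 1/e - ε) M`. -/
theorem greedy_recurrence_approx_factor
    (M ε : ℝ) (hM : 0 ≤ M) (hε0 : 0 ≤ ε) (hε1 : ε ≤ 1)
    (k : ℕ) (hk : 1 ≤ k) (x : ℕ → ℝ) (hx0 : x 0 = 0)
    (hstep : ∀ i < k, ((1 - ε) / k) * (M - x i) ≤ x (i + 1) - x i) :
    (1 - 1 / Real.exp 1 - ε) * M ≤ x k := by
  have hk' : (1 : ℝ) ≤ k := by exact_mod_cast hk
  have h_rate : (1 - ε) / k ≤ 1 := (div_le_one (by linarith)).2 (by linarith)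
  have h_gap := sub_le_one_sub_pow_mul h_rate hstep
  have h_exp : (1 - (1 - ε) / k) ^ k ≤ Real.exp (-(1 - ε)) :=
    Real.one_sub_div_pow_le_exp_neg (by linarith)
  have h_factor := mul_le_mul_of_nonneg_right (h_exp.trans (exp_neg_one_sub_le hε0 hε1)) hM
  rw [hx0, sub_zero] at h_gap
  linarith
end

section
/- Let f : Finset V → ℝ be a monotone submodular function on a nonempty finite ground set V, let k ≥ 1 be an integer, let A ⊆ V, and let A* ⊆ V with |A*| ≤ k. Then there exists an element a ∈ V such that f(A ∪ {a}) − f(A) ≥ (f(A*) − f(A))/k. -/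
/-- For a set function with diminishing marginal gains, the gain of adding `S` to `A` is at most
the sum of the gains of adding each element of `S` separately, if single-element gains are
nonnegative. -/
theorem union_gain_le_sum_gain {V : Type*} [DecidableEq V] (f : Finset V → ℝ)
    (hsub : ∀ A B : Finset V, A ⊆ B → ∀ i ∉ B,
      f (insert i B) - f B ≤ f (insert i A) - f A)
    (A : Finset V) (hgain : ∀ a, f A ≤ f (insert a A)) (S : Finset V) :
    f (A ∪ S) - f A ≤ ∑ a ∈ S, (f (insert a A) - f A) := by
  induction S using Finset.induction_on with
  | empty => simp
  | insert a S ha ih =>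
    rw [Finset.sum_insert ha, Finset.union_insert]
    by_cases h : a ∈ A ∪ S
    · rw [Finset.insert_eq_of_mem h]
      linarith [hgain a]
    · linarith [hsub A (A ∪ S) Finset.subset_union_left a h]

/-- Key per-step gain property of the classic greedy algorithm: for a monotone
submodular `f` on a nonempty finite ground set `V`, any `A ⊆ V` and any
`A* ⊆ V` with `|A*| ≤ k` (`k ≥ 1`), some element `a ∈ V` has marginal gain at
least `(f(A*) − f(A))/k`. -/
theorem greedy_step_gain
    {V : Type*} [Fintype V] [DecidableEq V] [Nonempty V]
    (f : Finset V → ℝ)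
    (hmono : ∀ A B : Finset V, A ⊆ B → f A ≤ f B)
    (hsub : ∀ A B : Finset V, A ⊆ B → ∀ i ∉ B,
      f (insert i B) - f B ≤ f (insert i A) - f A)
    (k : ℕ) (hk : 1 ≤ k)
    (A Astar : Finset V) (hcard : Astar.card ≤ k) :
    ∃ a : V, (f Astar - f A) / k ≤ f (insert a A) - f A := by
  have hgain (a : V) : f A ≤ f (insert a A) := hmono _ _ (Finset.subset_insert a A)
  obtain ⟨a, ha⟩ := Finite.exists_max fun a => f (insert a A) - f A
  refine ⟨a, ?_⟩
  rw [div_le_iff₀' (by exact_mod_cast hk)]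
  calc f Astar - f A ≤ f (A ∪ Astar) - f A :=
        sub_le_sub_right (hmono _ _ Finset.subset_union_right) _
    _ ≤ ∑ b ∈ Astar, (f (insert b A) - f A) := union_gain_le_sum_gain f hsub A hgain Astar
    _ ≤ Astar.card • (f (insert a A) - f A) := Finset.sum_le_card_nsmul _ _ _ fun b _ => ha b
    _ = Astar.card * (f (insert a A) - f A) := nsmul_eq_mul _ _
    _ ≤ k * (f (insert a A) - f A) :=
        mul_le_mul_of_nonneg_right (by exact_mod_cast hcard) (sub_nonneg.2 (hgain a))
end
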